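/- arXiv:1302.6482 — 2 statements merged into one kernel-verified Lean document; each statement's English description precedes it below -/
import Mathlib

section
/- Let G be a connected string graph with n vertices and m edges. Then the complete graph K_n on the vertex set of G admits a drawing in the plane in which at most 8·m·vcong(G)² pairs of edges cross; in particular, pcr(K_n) ≤ 8·m·vcong(G)². -/
open Finset

/-- A curve from `x` to `y`: the image of a continuous map `[0,1] → ℝ²`
with prescribed endpoints. -/
def IsArc (c : Set (ℝ × ℝ)) (x y : ℝ × ℝ) : Prop :=
  ∃ f : ℝ → ℝ × ℝ, ContinuousOn f (Set.Icc 0 1) ∧ c = f '' Set.Icc 0 1 ∧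
    f 0 = x ∧ f 1 = y

/-- A curve: the image of a continuous map `[0,1] → ℝ²`. -/
def IsCurve (c : Set (ℝ × ℝ)) : Prop := ∃ x y, IsArc c x y

/-- `G` is a string graph: an intersection graph of curves in the plane. -/
def SimpleGraph.IsStringGraph {V : Type*} (G : SimpleGraph V) : Prop :=
  ∃ γ : V → Set (ℝ × ℝ), (∀ v, IsCurve (γ v)) ∧
    ∀ u v : V, (γ u ∩ γ v).Nonempty ↔ (G.Adj u v ∨ u = v)

/-- `S` is a separator in `G`. -/
def SimpleGraph.IsSeparator {V : Type*} [Fintype V] [DecidableEq V]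
    (G : SimpleGraph V) (S : Finset V) : Prop :=
  ∃ V₁ V₂ : Finset V, V₁ ∪ V₂ ∪ S = Finset.univ ∧
    Disjoint V₁ V₂ ∧ Disjoint V₁ S ∧ Disjoint V₂ S ∧
    3 * V₁.card ≤ 2 * Fintype.card V ∧ 3 * V₂.card ≤ 2 * Fintype.card V ∧
    ∀ u ∈ V₁, ∀ v ∈ V₂, ¬ G.Adj u v

section Flows

variable {V : Type*} [Fintype V] (G : SimpleGraph V)

/-- An all-pair unit-demand multicommodity flow in `G`, presented symmetrically on
ordered pairs: `φ u v p = φ v u p.reverse` represents the flow on the (undirected)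
path `p ∈ 𝒫_{uv}`, and the flows on `𝒫_{uv}` sum to `1` for every pair `u ≠ v`. -/
def SimpleGraph.IsMCFlow (φ : ∀ u v : V, G.Path u v → ℝ) : Prop :=
  letI := Classical.decEq V
  letI : DecidableRel G.Adj := fun _ _ => Classical.dec _
  (∀ u v p, φ u v p ∈ Set.Icc (0 : ℝ) 1) ∧
  (∀ u v (p : G.Path u v), φ v u p.reverse = φ u v p) ∧
  (∀ u v : V, u ≠ v → ∑ p : G.Path u v, φ u v p = 1)

/-- The coefficient with which a path `p` counts towards the congestion of `w`:
`1` if `w` is an internal vertex of `p`, `1/2` if `w` is an endpoint of `p`. -/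
noncomputable def pathCoeff (w : V) {u v : V} (p : G.Walk u v) : ℝ :=
  letI := Classical.decEq V
  if w ∈ p.support then (if w = u ∨ w = v then 1 / 2 else 1) else 0

/-- The congestion of a vertex `w` under the flow `φ`; the factor `1/2` compensates
the fact that each undirected path is counted by both its orientations. -/
noncomputable def SimpleGraph.congestion (φ : ∀ u v : V, G.Path u v → ℝ) (w : V) : ℝ :=
  letI := Classical.decEq V
  letI : DecidableRel G.Adj := fun _ _ => Classical.dec _
  (1 / 2) * ∑ u : V, ∑ v : V, ∑ p : G.Path u v, φ u v p * pathCoeff G w p.1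

/-- The optimal vertex congestion `vcong G`. -/
noncomputable def SimpleGraph.vcong : ℝ :=
  sInf { x : ℝ | ∃ φ : ∀ u v : V, G.Path u v → ℝ,
    G.IsMCFlow φ ∧ x = ⨆ w : V, G.congestion φ w }

/-- `vcong* G`: the minimum of `vcong H` over all subgraphs `H` of `G` on at least
two thirds of the vertices. -/
noncomputable def SimpleGraph.vcongStar : ℝ :=
  sInf { x : ℝ | ∃ H : G.Subgraph, 2 * Fintype.card V ≤ 3 * H.verts.ncard ∧
    x = letI : Fintype ↥H.verts := H.verts.toFinite.fintype
        H.coe.vcong }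

end Flows

section Drawings

variable {V : Type*} (G : SimpleGraph V)

/-- A drawing of a graph `G` in the plane: vertices are represented by distinct
points, each edge by a curve joining the points of its endpoints, no edge passes
through the point of a vertex other than its endpoints, and any two distinct edges
share only finitely many points. -/
structure SimpleGraph.Drawing where
  pt : V → ℝ × ℝ
  pt_inj : Function.Injective pt
  arc : G.edgeSet → Set (ℝ × ℝ)
  arc_isArc : ∀ e : G.edgeSet, ∃ u v : V, (e : Sym2 V) = s(u, v) ∧
    IsArc (arc e) (pt u) (pt v)
  arc_vertex : ∀ (e : G.edgeSet) (w : V), pt w ∈ arc e → w ∈ (e : Sym2 V)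
  arc_finite : ∀ e e' : G.edgeSet, e ≠ e' → (arc e ∩ arc e').Finite

/-- The set of crossings between (the arcs of) two edges in a drawing: common
points that are not points of shared endpoints. -/
def SimpleGraph.Drawing.crossSet {G : SimpleGraph V} (D : G.Drawing)
    (e e' : G.edgeSet) : Set (ℝ × ℝ) :=
  (D.arc e ∩ D.arc e') \ {x | ∃ w : V, D.pt w = x ∧ w ∈ (e : Sym2 V) ∧ w ∈ (e' : Sym2 V)}

/-- The number of unordered pairs of edges that cross in a drawing. -/
noncomputable def SimpleGraph.Drawing.crossingPairCount {G : SimpleGraph V}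
    (D : G.Drawing) : ℕ :=
  Nat.card {p : G.edgeSet × G.edgeSet // p.1 ≠ p.2 ∧ (D.crossSet p.1 p.2).Nonempty} / 2

/-- The total number of crossings in a drawing. -/
noncomputable def SimpleGraph.Drawing.crossingCount {G : SimpleGraph V}
    (D : G.Drawing) : ℕ :=
  (∑ᶠ (e : G.edgeSet) (e' : G.edgeSet) (_ : e ≠ e'), (D.crossSet e e').ncard) / 2

/-- The pair-crossing number of `G`. -/
noncomputable def SimpleGraph.pcr : ℕ :=
  sInf { k : ℕ | ∃ D : G.Drawing, D.crossingPairCount = k }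

/-- The crossing number of `G`. -/
noncomputable def SimpleGraph.cr : ℕ :=
  sInf { k : ℕ | ∃ D : G.Drawing, D.crossingCount = k }

end Drawings

section Helpers

open Topology Filter

theorem IsArc.union {c c' : Set (ℝ × ℝ)} {x y z : ℝ × ℝ} (h : IsArc c x y) (h' : IsArc c' y z) :
    IsArc (c ∪ c') x z := by
  obtain ⟨f, hf, rfl, rfl, rfl⟩ := h
  obtain ⟨g, hg, rfl, hg0, rfl⟩ := h'
  let p : Path (f 0) (f 1) := ⟨⟨fun t : unitInterval => f t, by
    exact continuousOn_iff_continuous_domRestrict.1 hf⟩, by simp, by simp⟩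
  let q : Path (f 1) (g 1) := ⟨⟨fun t : unitInterval => g t, by
    exact continuousOn_iff_continuous_domRestrict.1 hg⟩, by simp [hg0], by simp⟩
  have hp : Set.range p = f '' Set.Icc 0 1 := by
    ext a; constructor
    · rintro ⟨t, rfl⟩; exact ⟨t, t.2, rfl⟩
    · rintro ⟨t, ht, rfl⟩; exact ⟨⟨t, ht⟩, rfl⟩
  have hq : Set.range q = g '' Set.Icc 0 1 := by
    ext a; constructor
    · rintro ⟨t, rfl⟩; exact ⟨t, t.2, rfl⟩
    · rintro ⟨t, ht, rfl⟩; exact ⟨⟨t, ht⟩, rfl⟩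
  refine ⟨(p.trans q).extend, (p.trans q).continuous_extend.continuousOn, ?_, by simp, by simp⟩
  rw [← hp, ← hq, ← Path.trans_range]
  ext a; constructor
  · rintro ⟨t, rfl⟩; exact ⟨t, t.2, by simp⟩
  · rintro ⟨t, ht, rfl⟩; exact ⟨⟨t, ht⟩, by rw [Path.extend_apply _ ht]⟩

theorem isArc_segment (x y : ℝ × ℝ) : IsArc (segment ℝ x y) x y := by
  refine ⟨fun t => AffineMap.lineMap x y t, ?_, ?_, by simp, by simp⟩
  · exact (AffineMap.lineMap_continuous).continuousOn
  · exact segment_eq_image_lineMap ℝ x y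

theorem isArc_poly (q : ℕ → ℝ × ℝ) (N : ℕ) :
    IsArc (⋃ i ∈ Finset.range (N + 1), segment ℝ (q i) (q (i + 1))) (q 0) (q (N + 1)) := by
  induction N with
  | zero => simpa using isArc_segment (q 0) (q 1)
  | succ n ih =>
    have := ih.union (isArc_segment (q (n + 1)) (q (n + 2)))
    convert this using 1
    rw [Finset.range_add_one, Finset.set_biUnion_insert, Set.union_comm]

def crs (a b c : ℝ × ℝ) : ℝ := (b.1 - a.1) * (c.2 - a.2) - (b.2 - a.2) * (c.1 - a.1)

theorem crs_dense {a b : ℝ × ℝ} (h : a ≠ b) : Dense {x | crs a b x ≠ 0} := by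
  have hpos : 0 < (b.1 - a.1) ^ 2 + (b.2 - a.2) ^ 2 := by
    by_contra hc
    apply h
    have h1 : b.1 - a.1 = 0 := by nlinarith [sq_nonneg (b.1 - a.1), sq_nonneg (b.2 - a.2)]
    have h2 : b.2 - a.2 = 0 := by nlinarith [sq_nonneg (b.1 - a.1), sq_nonneg (b.2 - a.2)]
    exact Prod.ext (by linarith) (by linarith)
  intro x
  by_cases hx : crs a b x = 0
  swap
  · exact subset_closure hx
  let g : ℝ → ℝ × ℝ := fun t => (x.1 - t * (b.2 - a.2), x.2 + t * (b.1 - a.1))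
  have hg : Continuous g := by fun_prop
  have ht : Tendsto g (𝓝[≠] 0) (𝓝 x) := by
    have : Tendsto g (𝓝 0) (𝓝 (g 0)) := hg.tendsto 0
    have h0 : g 0 = x := by simp [g]
    rw [h0] at this
    exact this.mono_left nhdsWithin_le_nhds
  refine mem_closure_of_tendsto ht ?_
  filter_upwards [self_mem_nhdsWithin] with t ht
  have : crs a b (g t) = crs a b x + t * ((b.1 - a.1) ^ 2 + (b.2 - a.2) ^ 2) := by
    simp only [crs, g]; ring
  show crs a b (g t) ≠ 0
  rw [this, hx, zero_add]
  exact mul_ne_zero ht hpos.ne'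

theorem crs_open (a b : ℝ × ℝ) : IsOpen {x | crs a b x ≠ 0} := by
  apply isOpen_ne_fun
  · unfold crs; fun_prop
  · fun_prop

theorem crs_rot (a b c : ℝ × ℝ) : crs b c a = crs a b c := by unfold crs; ring
theorem crs_swap (a b c : ℝ × ℝ) : crs b a c = - crs a b c := by unfold crs; ring

theorem exists_generic {I : Type} [Finite I] (O : I → Set (ℝ × ℝ)) (hO : ∀ i, IsOpen (O i))
    (hne : ∀ i, (O i).Nonempty) :
    ∃ z : I → ℝ × ℝ, (∀ i, z i ∈ O i) ∧ Function.Injective z ∧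
      ∀ a b c, a ≠ b → a ≠ c → b ≠ c → crs (z a) (z b) (z c) ≠ 0 := by
  classical
  have := Fintype.ofFinite I
  suffices H : ∀ s : Finset I, ∃ z : I → ℝ × ℝ, (∀ i ∈ s, z i ∈ O i) ∧
      (∀ a ∈ s, ∀ b ∈ s, a ≠ b → z a ≠ z b) ∧
      ∀ a ∈ s, ∀ b ∈ s, ∀ c ∈ s, a ≠ b → a ≠ c → b ≠ c → crs (z a) (z b) (z c) ≠ 0 by
    obtain ⟨z, h1, h2, h3⟩ := H Finset.univ
    refine ⟨z, fun i => h1 i (Finset.mem_univ _), ?_, fun a b c => h3 a (by simp) b (by simp) c (by simp)⟩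
    intro a b hab
    by_contra hne
    exact h2 a (by simp) b (by simp) hne hab
  intro s
  induction s using Finset.induction_on with
  | empty => exact ⟨fun _ => 0, by simp, by simp, by simp⟩
  | insert n s hn ih =>
    obtain ⟨z, h1, h2, h3⟩ := ih
    have hd1 : Dense (⋂ a : I, ({z a}ᶜ : Set (ℝ × ℝ))) :=
      dense_iInter_of_isOpen (fun a => isOpen_compl_singleton) (fun a => dense_compl_singleton _)
    have hd2 : Dense (⋂ p : {p : I × I // z p.1 ≠ z p.2}, {x | crs (z p.1.1) (z p.1.2) x ≠ 0}) :=
      dense_iInter_of_isOpen (fun p => crs_open _ _) (fun p => crs_dense p.2)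
    have ho1 : IsOpen (⋂ a : I, ({z a}ᶜ : Set (ℝ × ℝ))) :=
      isOpen_iInter_of_finite (fun a => isOpen_compl_singleton)
    obtain ⟨x, hxO, hx1, hx2⟩ := (hd1.inter_of_isOpen_left hd2 ho1).inter_open_nonempty _ (hO n) (hne n)
    simp only [Set.mem_iInter, Set.mem_compl_iff, Set.mem_singleton_iff, Set.mem_ofPred_eq,
      Subtype.forall, Prod.forall] at hx1 hx2
    have hs : ∀ a ∈ s, a ≠ n := fun a ha h => hn (h ▸ ha)
    refine ⟨Function.update z n x, ?_, ?_, ?_⟩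
    · intro i hi
      rcases Finset.mem_insert.1 hi with rfl | hi
      · simpa using hxO
      · rw [Function.update_of_ne (hs i hi)]; exact h1 i hi
    · intro a ha b hb hab
      rcases Finset.mem_insert.1 ha with rfl | has <;> rcases Finset.mem_insert.1 hb with rfl | hbs
      · exact absurd rfl hab
      · rw [Function.update_self, Function.update_of_ne (hs b hbs)]; exact hx1 b
      · rw [Function.update_self, Function.update_of_ne (hs a has)]; exact Ne.symm (hx1 a)
      · rw [Function.update_of_ne (hs a has), Function.update_of_ne (hs b hbs)]; exact h2 a has b hbs hab
    · have key : ∀ a ∈ s, ∀ b ∈ s, a ≠ b → crs (z a) (z b) x ≠ 0 := fun a ha b hb hab =>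
        hx2 a b (h2 a ha b hb hab)
      intro a ha b hb c hc hab hac hbc
      rcases Finset.mem_insert.1 ha with rfl | has <;> rcases Finset.mem_insert.1 hb with rfl | hbs <;>
        rcases Finset.mem_insert.1 hc with rfl | hcs <;> first | contradiction | skip
      · rw [Function.update_self, Function.update_of_ne (hs b hbs), Function.update_of_ne (hs c hcs),
          ← crs_rot]
        exact key b hbs c hcs hbc
      · rw [Function.update_self, Function.update_of_ne (hs a has), Function.update_of_ne (hs c hcs),
          ← crs_rot, ← crs_rot]
        exact key c hcs a has hac.symm
      · rw [Function.update_self, Function.update_of_ne (hs a has), Function.update_of_ne (hs b hbs)]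
        exact key a has b hbs hab
      · rw [Function.update_of_ne (hs a has), Function.update_of_ne (hs b hbs),
          Function.update_of_ne (hs c hcs)]
        exact h3 a has b hbs c hcs hab hac hbc

theorem mem_seg {a b p : ℝ × ℝ} (h : p ∈ segment ℝ a b) :
    ∃ s : ℝ, p.1 = a.1 + s * (b.1 - a.1) ∧ p.2 = a.2 + s * (b.2 - a.2) := by
  rw [segment_eq_image'] at h
  obtain ⟨s, -, rfl⟩ := h
  exact ⟨s, by simp, by simp⟩

theorem crs_of_seg {a b p : ℝ × ℝ} (h : p ∈ segment ℝ a b) : crs a b p = 0 := by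
  obtain ⟨s, h1, h2⟩ := mem_seg h
  unfold crs; rw [h1, h2]; ring

theorem crs_of_two {a b c d p q : ℝ × ℝ} (hpq : p ≠ q) (h1 : p ∈ segment ℝ a b)
    (h2 : q ∈ segment ℝ a b) (h3 : p ∈ segment ℝ c d) (h4 : q ∈ segment ℝ c d) :
    crs a b c = 0 ∧ crs a b d = 0 := by
  obtain ⟨s, s1, s2⟩ := mem_seg h1
  obtain ⟨s', s1', s2'⟩ := mem_seg h2
  obtain ⟨t, t1, t2⟩ := mem_seg h3
  obtain ⟨t', t1', t2'⟩ := mem_seg h4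
  have ht : t' - t ≠ 0 := by
    intro h
    have : t' = t := by linarith
    subst this
    exact hpq (Prod.ext (by rw [t1, t1']) (by rw [t2, t2']))
  rw [s1] at t1
  rw [s2] at t2
  rw [s1'] at t1'
  rw [s2'] at t2'
  have hd : crs a b d = crs a b c + ((b.1 - a.1) * (d.2 - c.2) - (b.2 - a.2) * (d.1 - c.1)) := by
    unfold crs; ring
  have h0 : (t' - t) * ((b.1 - a.1) * (d.2 - c.2) - (b.2 - a.2) * (d.1 - c.1)) = 0 := by
    linear_combination (b.1 - a.1) * (t2 - t2') - (b.2 - a.2) * (t1 - t1')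
  have h0' := (mul_eq_zero.1 h0).resolve_left ht
  have hc : crs a b c = 0 := by
    unfold crs
    linear_combination (-(b.1 - a.1)) * t2 + (b.2 - a.2) * t1 - t * h0'
  exact ⟨hc, by rw [hd, hc, h0']; ring⟩

/-- eventually constant chains -/
theorem exists_chain {S : Set (ℝ × ℝ)} (hS : IsPreconnected S) {ε : ℝ} (hε : 0 < ε)
    {x y : ℝ × ℝ} (hx : x ∈ S) (hy : y ∈ S) :
    ∃ f : ℕ → ℝ × ℝ, ∃ k, f 0 = x ∧ (∀ i, k ≤ i → f i = y) ∧ (∀ i, f i ∈ S) ∧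
      ∀ i, dist (f i) (f (i + 1)) < ε := by
  let R : ℝ × ℝ → ℝ × ℝ → Prop := fun a b => a ∈ S ∧ b ∈ S ∧ dist a b < ε
  have hR : Relation.ReflTransGen R x y := by
    refine hS.induction₂' (fun a b => Relation.ReflTransGen R a b) ?_ ?_ hx hy
    · intro a ha
      filter_upwards [self_mem_nhdsWithin, mem_nhdsWithin_of_mem_nhds (Metric.ball_mem_nhds a hε)]
        with b hb hab
      exact ⟨.single ⟨ha, hb, by rw [dist_comm]; exact hab⟩, .single ⟨hb, ha, hab⟩⟩
    · intro a b c _ _ _ h1 h2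
      exact h1.trans h2
  clear hy
  induction hR using Relation.ReflTransGen.head_induction_on with
  | refl => exact ⟨fun _ => y, 0, rfl, fun _ _ => rfl, fun _ => hx, fun _ => by simpa⟩
  | @head a b h _ ih =>
    obtain ⟨f, k, h0, h1, h2, h3⟩ := ih h.2.1
    refine ⟨fun i => Nat.casesOn i a f, k + 1, rfl, ?_, ?_, ?_⟩
    · rintro (_ | i) hi
      · omega
      · exact h1 i (by omega)
    · rintro (_ | i)
      · exact hx
      · exact h2 i
    · rintro (_ | i)
      · show dist _ (f 0) < ε
        rw [h0]; exact h.2.2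
      · exact h3 i


theorem walk_preconnected {V : Type} {G : SimpleGraph V} {γ : V → Set (ℝ × ℝ)}
    (hγ : ∀ v, IsPreconnected (γ v)) (hadj : ∀ u v, G.Adj u v → (γ u ∩ γ v).Nonempty)
    {u v : V} (p : G.Walk u v) : IsPreconnected (⋃ w ∈ p.support, γ w) := by
  induction p with
  | nil => simpa using hγ _
  | @cons u v w h p ih =>
    have : (⋃ x ∈ (SimpleGraph.Walk.cons h p).support, γ x) = γ u ∪ ⋃ x ∈ p.support, γ x := by
      simp [Set.iUnion_or, Set.iUnion_union_distrib]
    rw [this]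
    refine IsPreconnected.union' ?_ (hγ u) ih
    obtain ⟨x, hx, hx'⟩ := hadj u v h
    exact ⟨x, hx, Set.mem_biUnion (x := v) p.start_mem_support hx'⟩

theorem exists_sep {V : Type} [Finite V] {G : SimpleGraph V} {γ : V → Set (ℝ × ℝ)}
    (hγ : ∀ v, IsCompact (γ v))
    (hadj : ∀ u v : V, (γ u ∩ γ v).Nonempty ↔ (G.Adj u v ∨ u = v)) :
    ∃ δ : ℝ, 0 < δ ∧ ∀ u v, ∀ x ∈ γ u, ∀ y ∈ γ v, dist x y < δ → G.Adj u v ∨ u = v := by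
  have : ∀ᶠ δ in 𝓝[>] (0 : ℝ), ∀ u v, ∀ x ∈ γ u, ∀ y ∈ γ v, dist x y < δ → G.Adj u v ∨ u = v := by
    rw [Filter.eventually_all]; intro u
    rw [Filter.eventually_all]; intro v
    by_cases h : G.Adj u v ∨ u = v
    · exact Filter.Eventually.of_forall fun _ _ _ _ _ _ => h
    · have hd : Disjoint (γ u) (γ v) := by
        rw [Set.disjoint_iff_inter_eq_empty, ← Set.not_nonempty_iff_eq_empty, hadj]; exact h
      obtain ⟨r, hr, hrr⟩ := Metric.exists_pos_forall_lt_edist (hγ u) (hγ v).isClosed hd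
      filter_upwards [Ioo_mem_nhdsGT (show (0 : ℝ) < r from hr)] with δ hδ x hx y hy hxy
      have h1 := hrr x hx y hy
      rw [edist_nndist, ENNReal.coe_lt_coe, ← NNReal.coe_lt_coe, coe_nndist] at h1
      linarith [hδ.2]
  obtain ⟨δ, h1, h2⟩ := (this.and self_mem_nhdsWithin).exists
  exact ⟨δ, h2, h1⟩

theorem exists_drawing {V : Type} [Finite V] {G : SimpleGraph V} (hstring : G.IsStringGraph)
    (src tgt : (⊤ : SimpleGraph V).edgeSet → V)
    (hst : ∀ e : (⊤ : SimpleGraph V).edgeSet, (e : Sym2 V) = s(src e, tgt e))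
    (P : ∀ e, G.Walk (src e) (tgt e)) :
    ∃ D : (⊤ : SimpleGraph V).Drawing, ∀ e e', e ≠ e' → (D.crossSet e e').Nonempty →
      ∃ w ∈ (P e).support, ∃ w' ∈ (P e').support, G.Adj w w' ∨ w = w' := by
  classical
  obtain ⟨γ, hcurve, hadj⟩ := hstring
  have hcomp : ∀ v, IsCompact (γ v) := by
    intro v
    obtain ⟨x, y, f, hf, h, -⟩ := hcurve v
    rw [h]; exact isCompact_Icc.image_of_continuousOn hf
  have hconn : ∀ v, IsPreconnected (γ v) := by
    intro v
    obtain ⟨x, y, f, hf, h, -⟩ := hcurve v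
    rw [h]; exact isPreconnected_Icc.image f hf
  have hne : ∀ v, ∃ x, x ∈ γ v := by
    intro v
    obtain ⟨x, y, f, hf, h, -⟩ := hcurve v
    exact ⟨f 0, by rw [h]; exact ⟨0, by simp, rfl⟩⟩
  choose b hb using hne
  obtain ⟨δ, hδ, hsep⟩ := exists_sep hcomp hadj
  have hε : 0 < δ / 8 := by linarith
  have hchain := fun e => exists_chain
    (walk_preconnected hconn (fun u v h => (hadj u v).2 (Or.inl h)) (P e)) hε
    (Set.mem_biUnion (x := src e) (P e).start_mem_support (hb _))
    (Set.mem_biUnion (x := tgt e) (P e).end_mem_support (hb _))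
  choose f k hf0 hfk hfS hfd using hchain
  obtain ⟨N, hN⟩ : ∃ N, ∀ e, k e ≤ N := by
    obtain ⟨N, hN⟩ := (Set.finite_range k).bddAbove
    exact ⟨N, fun e => hN ⟨e, rfl⟩⟩
  -- index type
  let I := V ⊕ ((⊤ : SimpleGraph V).edgeSet × Fin (N + 1))
  let ctr : I → ℝ × ℝ := Sum.elim b (fun p => f p.1 (p.2 + 1))
  obtain ⟨z, hzO, hzi, hzc⟩ := exists_generic (I := I) (fun i => Metric.ball (ctr i) (δ / 8))
    (fun i => Metric.isOpen_ball) (fun i => ⟨ctr i, Metric.mem_ball_self hε⟩)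
  -- index sequence
  let ix : (⊤ : SimpleGraph V).edgeSet → ℕ → I := fun e i =>
    if i = 0 then Sum.inl (src e) else
      if h : i < N + 2 then Sum.inr (e, ⟨i - 1, by omega⟩) else Sum.inl (tgt e)
  have hctr : ∀ e i, ctr (ix e i) = f e i := by
    intro e i
    by_cases h0 : i = 0
    · subst h0; simp [ix, ctr, hf0]
    · by_cases h : i < N + 2
      · simp only [ix, ctr, h0, h, if_false, dif_pos, Sum.elim_inr]
        congr 1; omega
      · simp only [ix, ctr, h0, h, if_false, dif_neg, not_false_eq_true, Sum.elim_inl]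
        rw [hfk]; have := hN e; omega
  have hsd : ∀ e : (⊤ : SimpleGraph V).edgeSet, src e ≠ tgt e := by
    intro e
    have := e.2
    rw [hst e] at this
    simpa using this
  have hixne : ∀ e i, i < N + 2 → ix e i ≠ ix e (i + 1) := by
    intro e i hi
    by_cases h0 : i = 0
    · subst h0; simp [ix]
    · by_cases h : i + 1 < N + 2
      · simp only [ix, h0, hi, h, if_false, dif_pos, Nat.succ_ne_zero]
        intro h
        have := Sum.inr_injective h
        simp at this; omega
      · simp [ix, h0, hi, h]
  -- the inner index on each segment
  have hinr : ∀ e i, i < N + 2 → ∃ j, ix e i = Sum.inr (e, j) ∨ ix e (i + 1) = Sum.inr (e, j) := by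
    intro e i hi
    by_cases h0 : i = 0
    · subst h0; exact ⟨⟨0, by omega⟩, Or.inr (by simp [ix])⟩
    · exact ⟨⟨i - 1, by omega⟩, Or.inl (by simp [ix, h0, hi])⟩
  have hinr' : ∀ e e' i j, ix e i = Sum.inr (e', j) → e = e' := by
    intro e e' i j h
    by_cases h0 : i = 0
    · subst h0; simp [ix] at h
    · by_cases hi : i < N + 2
      · simp [ix, h0, hi] at h; exact congrArg Prod.fst (Sum.inr_injective h)
      · simp [ix, h0, hi] at h
  have hinl : ∀ e i w, ix e i = Sum.inl w → w ∈ (e : Sym2 V) := by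
    intro e i w h
    rw [hst e]
    by_cases h0 : i = 0
    · subst h0; simp [ix] at h; simp [Sum.inl_injective h]
    · by_cases hi : i < N + 2
      · simp [ix, h0, hi] at h
      · simp [ix, h0, hi] at h; simp [Sum.inl_injective h]
  let arc : (⊤ : SimpleGraph V).edgeSet → Set (ℝ × ℝ) := fun e =>
    ⋃ i ∈ Finset.range (N + 2), segment ℝ (z (ix e i)) (z (ix e (i + 1)))
  have harc : ∀ e x, x ∈ arc e ↔ ∃ i, i < N + 2 ∧
      x ∈ segment ℝ (z (ix e i)) (z (ix e (i + 1))) := by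
    intro e x; simp [arc]
  have hclose : ∀ e x, x ∈ arc e → ∃ w ∈ (P e).support, ∃ y ∈ γ w, dist x y < δ / 2 := by
    intro e x hx
    obtain ⟨i, hi, hx⟩ := (harc e x).1 hx
    have h1 := hfS e i
    simp only [Set.mem_iUnion] at h1
    obtain ⟨w, hw, hy⟩ := h1
    refine ⟨w, hw, f e i, hy, ?_⟩
    have h2 : z (ix e i) ∈ Metric.ball (f e i) (δ / 2) := by
      have := hzO (ix e i); rw [hctr] at this
      exact Metric.ball_subset_ball (by linarith) this
    have h3 : z (ix e (i + 1)) ∈ Metric.ball (f e i) (δ / 2) := by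
      have := hzO (ix e (i + 1)); rw [hctr, Metric.mem_ball] at this
      have h4 := hfd e i
      rw [Metric.mem_ball]
      have h5 := dist_triangle (z (ix e (i + 1))) (f e (i + 1)) (f e i)
      rw [dist_comm (f e (i + 1))] at h5
      linarith
    exact (convex_ball (f e i) (δ / 2)).segment_subset h2 h3 hx
  refine ⟨⟨fun v => z (Sum.inl v), fun a b h => Sum.inl_injective (hzi h), arc, ?_, ?_, ?_⟩, ?_⟩
  · intro e
    refine ⟨src e, tgt e, hst e, ?_⟩
    have := isArc_poly (fun i => z (ix e i)) (N + 1)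
    have e0 : ix e 0 = Sum.inl (src e) := by simp [ix]
    have e1 : ix e (N + 1 + 1) = Sum.inl (tgt e) := by simp [ix]
    simp only [e0, e1] at this
    exact this
  · intro e w hw
    obtain ⟨i, hi, hx⟩ := (harc e _).1 hw
    have hc := crs_of_seg hx
    by_contra hcon
    refine hzc _ _ _ (hixne e i hi) ?_ ?_ hc
    · intro h; exact hcon (hinl _ _ _ h)
    · intro h; exact hcon (hinl _ _ _ h)
  · intro e e' hee
    have : arc e ∩ arc e' ⊆ ⋃ i ∈ Finset.range (N + 2), ⋃ j ∈ Finset.range (N + 2),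
        (segment ℝ (z (ix e i)) (z (ix e (i + 1))) ∩
          segment ℝ (z (ix e' j)) (z (ix e' (j + 1)))) := by
      rintro x ⟨hx, hx'⟩
      obtain ⟨i, hi, hx⟩ := (harc e x).1 hx
      obtain ⟨j, hj, hx'⟩ := (harc e' x).1 hx'
      simp only [Set.mem_iUnion, Finset.mem_range]
      exact ⟨i, hi, j, hj, hx, hx'⟩
    refine Set.Finite.subset ?_ this
    refine Set.Finite.biUnion (Finset.finite_toSet _) fun i hi => ?_
    refine Set.Finite.biUnion (Finset.finite_toSet _) fun j hj => ?_
    have hi : i < N + 2 := by simpa using hi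
    have hj : j < N + 2 := by simpa using hj
    apply Set.Subsingleton.finite
    rintro p ⟨hp, hp'⟩ q ⟨hq, hq'⟩
    by_contra hpq
    obtain ⟨h1, h2⟩ := crs_of_two hpq hp hq hp' hq'
    obtain ⟨l, hl⟩ := hinr e' j hj
    have hne : ∀ i, ix e i ≠ Sum.inr (e', l) := fun i h => hee (hinr' _ _ _ _ h)
    rcases hl with hl | hl
    · rw [hl] at h1
      exact hzc _ _ _ (hixne e i hi) (hne _) (hne _) h1
    · rw [hl] at h2
      exact hzc _ _ _ (hixne e i hi) (hne _) (hne _) h2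
  · rintro e e' - ⟨x, ⟨hx, hx'⟩, -⟩
    obtain ⟨w, hw, y, hy, hd⟩ := hclose e x hx
    obtain ⟨w', hw', y', hy', hd'⟩ := hclose e' x hx'
    refine ⟨w, hw, w', hw', hsep w w' y hy y' hy' ?_⟩
    have := dist_triangle_left y y' x
    linarith


theorem indep_two {E : Type} [Fintype E] [DecidableEq E] (β : E → Type) [∀ e, Fintype (β e)]
    (φ X Y : ∀ e, β e → ℝ) (h1 : ∀ e, ∑ p, φ e p = 1) {e e' : E} (hee : e ≠ e') :
    ∑ c : (∀ i, β i), (∏ i, φ i (c i)) * (X e (c e) * Y e' (c e')) =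
      (∑ p, φ e p * X e p) * (∑ p, φ e' p * Y e' p) := by
  classical
  let h : ∀ i, β i → ℝ := fun i p => (if i = e then X i p else 1) * (if i = e' then Y i p else 1)
  have hh : ∀ c : (∀ i, β i), (∏ i, φ i (c i)) * (X e (c e) * Y e' (c e')) =
      ∏ i, (φ i (c i) * h i (c i)) := by
    intro c
    rw [Finset.prod_mul_distrib]
    congr 1
    simp only [h, Finset.prod_mul_distrib, Finset.prod_ite_eq', Finset.mem_univ, if_true]
  simp_rw [hh]
  rw [← Fintype.piFinset_univ, ← Finset.prod_univ_sum (fun i => Finset.univ)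
    (fun i p => φ i p * h i p)]
  rw [Fintype.prod_eq_mul e e' hee]
  · simp [h, hee, hee.symm]
  · rintro i ⟨hi, hi'⟩
    simp [h, hi, hi', h1]

theorem exists_choice {E V : Type} [Fintype E] [DecidableEq E] (β : E → Type)
    [∀ e, Fintype (β e)]
    (φ : ∀ e, β e → ℝ) (h0 : ∀ e p, 0 ≤ φ e p) (h1 : ∀ e, ∑ p, φ e p = 1)
    (X : V → ∀ e, β e → ℝ) (hX : ∀ w e p, 0 ≤ X w e p)
    (R : Finset (V × V)) (C : ℝ) (hC : ∀ w, ∑ e, ∑ p, φ e p * X w e p ≤ C) :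
    ∃ c : (∀ e, β e), ∑ q : E × E, (if q.1 ≠ q.2 then
      ∑ r ∈ R, X r.1 q.1 (c q.1) * X r.2 q.2 (c q.2) else 0) ≤ R.card * C ^ 2 := by
  classical
  set K : ℝ := R.card * C ^ 2 with hK
  let cnt : (∀ e, β e) → ℝ := fun c => ∑ q : E × E, (if q.1 ≠ q.2 then
      ∑ r ∈ R, X r.1 q.1 (c q.1) * X r.2 q.2 (c q.2) else 0)
  let W : (∀ e, β e) → ℝ := fun c => ∏ i, φ i (c i)
  have hW0 : ∀ c, 0 ≤ W c := fun c => Finset.prod_nonneg fun i _ => h0 _ _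
  have hW1 : ∑ c, W c = 1 := by
    simp only [W]
    rw [← Fintype.piFinset_univ, ← Finset.prod_univ_sum (fun i => Finset.univ)
      (fun i p => φ i p)]
    simp [h1]
  have ha : ∀ w e, 0 ≤ ∑ p, φ e p * X w e p := fun w e =>
    Finset.sum_nonneg fun p _ => mul_nonneg (h0 _ _) (hX _ _ _)
  have hE : ∑ c, W c * cnt c ≤ K := by
    calc ∑ c, W c * cnt c = ∑ q : E × E, (if q.1 ≠ q.2 then
          ∑ r ∈ R, (∑ p, φ q.1 p * X r.1 q.1 p) * (∑ p, φ q.2 p * X r.2 q.2 p) else 0) := by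
          simp only [cnt, Finset.mul_sum]
          rw [Finset.sum_comm]
          refine Finset.sum_congr rfl fun q _ => ?_
          split_ifs with hq
          · simp only [Finset.mul_sum]
            rw [Finset.sum_comm]
            refine Finset.sum_congr rfl fun r _ => ?_
            rw [indep_two β φ (X r.1) (X r.2) h1 hq, Finset.mul_sum]
          · simp
      _ ≤ ∑ q : E × E, 
          ∑ r ∈ R, (∑ p, φ q.1 p * X r.1 q.1 p) * (∑ p, φ q.2 p * X r.2 q.2 p) := by
          refine Finset.sum_le_sum fun q _ => ?_
          split_ifs
          · exact le_rfl
          · exact Finset.sum_nonneg fun r _ => mul_nonneg (ha _ _) (ha _ _)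
      _ = ∑ r ∈ R, (∑ e, ∑ p, φ e p * X r.1 e p) * (∑ e, ∑ p, φ e p * X r.2 e p) := by
          rw [Finset.sum_comm]
          refine Finset.sum_congr rfl fun r _ => ?_
          rw [Fintype.sum_mul_sum, Fintype.sum_prod_type]
      _ ≤ ∑ r ∈ R, C ^ 2 := by
          refine Finset.sum_le_sum fun r _ => ?_
          rw [sq]
          have n1 : 0 ≤ ∑ e, ∑ p, φ e p * X r.1 e p := Finset.sum_nonneg fun e _ => ha _ _
          have n2 : 0 ≤ ∑ e, ∑ p, φ e p * X r.2 e p := Finset.sum_nonneg fun e _ => ha _ _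
          exact mul_le_mul (hC _) (hC _) n2 (n1.trans (hC _))
      _ = K := by simp [hK]
  by_contra hcon
  push Not at hcon
  have hcon' : ∀ c, K < cnt c := hcon
  have hs : ∑ c, W c * (cnt c - K) ≤ 0 := by
    simp only [mul_sub, Finset.sum_sub_distrib, ← Finset.sum_mul, hW1]
    linarith
  have hn : ∀ c ∈ Finset.univ, 0 ≤ W c * (cnt c - K) := fun c _ =>
    mul_nonneg (hW0 c) (by linarith [hcon' c])
  have hz := (Finset.sum_eq_zero_iff_of_nonneg hn).1 (le_antisymm hs (Finset.sum_nonneg hn))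
  have : ∑ c, W c = 0 := Finset.sum_eq_zero fun c hc => by
    rcases mul_eq_zero.1 (hz c hc) with h | h
    · exact h
    · linarith [hcon' c]
  linarith

theorem exists_flow {V : Type} [Fintype V] (G : SimpleGraph V) (hconn : G.Connected) :
    ∃ φ : ∀ u v : V, G.Path u v → ℝ, G.IsMCFlow φ := by
  letI := Classical.decEq V
  letI : DecidableRel G.Adj := fun _ _ => Classical.dec _
  have hcard : ∀ u v, 0 < Fintype.card (G.Path u v) := fun u v => by
    obtain ⟨p⟩ := hconn u v
    exact Fintype.card_pos_iff.2 ⟨p.toPath⟩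
  refine ⟨fun u v _ => 1 / Fintype.card (G.Path u v), ?_, ?_, ?_⟩
  · intro u v p
    have : (1 : ℝ) ≤ Fintype.card (G.Path u v) := by exact_mod_cast hcard u v
    constructor
    · positivity
    · rw [div_le_one (by linarith)]; exact this
  · intro u v p
    have : Fintype.card (G.Path v u) = Fintype.card (G.Path u v) :=
      Fintype.card_congr ⟨fun p => p.reverse, fun p => p.reverse,
        fun p => by ext1; simp, fun p => by ext1; simp⟩
    simp only [this]
  · intro u v _
    have := hcard u v
    have : (Fintype.card (G.Path u v) : ℝ) ≠ 0 := by positivity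
    simp [this]

theorem flow_bound {V : Type} [Fintype V] [DecidableEq V] (G : SimpleGraph V) [DecidableRel G.Adj]
    (φ : ∀ u v : V, G.Path u v → ℝ) (hφ : G.IsMCFlow φ)
    [Fintype (⊤ : SimpleGraph V).edgeSet]
    (src tgt : (⊤ : SimpleGraph V).edgeSet → V)
    (hst : ∀ e : (⊤ : SimpleGraph V).edgeSet, (e : Sym2 V) = s(src e, tgt e)) (w : V) :
    ∑ e, ∑ p : G.Path (src e) (tgt e), φ (src e) (tgt e) p * (if w ∈ p.1.support then 1 else 0)
      ≤ 2 * G.congestion φ w := by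
  obtain ⟨h0, hsym, -⟩ := hφ
  have hcg : G.congestion φ w =
      (1 / 2) * ∑ u : V, ∑ v : V, ∑ p : G.Path u v, φ u v p * pathCoeff G w p.1 := by
    unfold SimpleGraph.congestion
    congr!
  rw [hcg]
  let g : V × V → ℝ := fun q => ∑ p : G.Path q.1 q.2, φ q.1 q.2 p * (if w ∈ p.1.support then 1 else 0)
  have hg0 : ∀ q, 0 ≤ g q := fun q => Finset.sum_nonneg fun p _ =>
    mul_nonneg (h0 _ _ _).1 (by split_ifs <;> norm_num)
  have hgs : ∀ u v, g (u, v) = g (v, u) := by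
    intro u v
    refine Fintype.sum_equiv ⟨fun p => p.reverse, fun p => p.reverse,
        fun p => by ext1; simp, fun p => by ext1; simp⟩ _ _ ?_
    intro p
    have := hsym u v p
    simp [this]
  have hle : ∑ q : V × V, g q ≤ 2 * ∑ u : V, ∑ v : V, ∑ p : G.Path u v, φ u v p * pathCoeff G w p.1 := by
    rw [Fintype.sum_prod_type, Finset.mul_sum]
    refine Finset.sum_le_sum fun u _ => ?_
    rw [Finset.mul_sum]
    refine Finset.sum_le_sum fun v _ => ?_
    rw [Finset.mul_sum]
    refine Finset.sum_le_sum fun p _ => ?_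
    have hp := (h0 u v p).1
    have : (if w ∈ p.1.support then (1 : ℝ) else 0) ≤ 2 * pathCoeff G w p.1 := by
      unfold pathCoeff
      split_ifs <;> norm_num
    nlinarith [mul_le_mul_of_nonneg_left this hp]
  have hsd : ∀ e : (⊤ : SimpleGraph V).edgeSet, src e ≠ tgt e := by
    intro e
    have := e.2
    rw [hst e] at this
    simpa using this
  let ι : (⊤ : SimpleGraph V).edgeSet × Bool → V × V := fun x =>
    if x.2 then (src x.1, tgt x.1) else (tgt x.1, src x.1)
  have hι2 : ∀ x, (x.1 : Sym2 V) = s((ι x).1, (ι x).2) := by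
    rintro ⟨e, _ | _⟩
    · simp only [ι]; rw [hst e]; exact Sym2.eq_swap
    · simp only [ι]; rw [hst e]; rfl
  have hι : Function.Injective ι := by
    rintro ⟨e, b⟩ ⟨e', b'⟩ h
    have he : e = e' := by
      apply Subtype.ext
      have h1 := hι2 (e, b)
      have h2 := hι2 (e', b')
      rw [h] at h1
      exact h1.trans h2.symm
    subst he
    have := hsd e
    rcases b with _ | _ <;> rcases b' with _ | _ <;> simp [ι] at h ⊢
    · exact this h.2
    · exact this h.1
  have hsum : ∑ x, g (ι x) ≤ ∑ q, g q := by
    rw [← Finset.sum_image (f := g) (g := ι) (s := Finset.univ) (fun a _ b _ h => hι h)]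
    exact Finset.sum_le_univ_sum_of_nonneg hg0
  have h2 : ∑ x, g (ι x) = 2 * ∑ e, g (src e, tgt e) := by
    rw [Fintype.sum_prod_type, Finset.mul_sum]
    refine Finset.sum_congr rfl fun e _ => ?_
    simp [ι, hgs (tgt e) (src e)]; ring
  change ∑ e, g (src e, tgt e) ≤ _
  linarith

theorem pcr_le_of_flow {V : Type} [Fintype V] [DecidableEq V] (G : SimpleGraph V)
    [DecidableRel G.Adj] (hconn : G.Connected) (hstring : G.IsStringGraph)
    (φ : ∀ u v : V, G.Path u v → ℝ) (hφ : G.IsMCFlow φ) (x : ℝ)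
    (hx : (⨆ w : V, G.congestion φ w) < x) :
    ∃ D : (⊤ : SimpleGraph V).Drawing,
      (D.crossingPairCount : ℝ) ≤ 8 * G.edgeFinset.card * x ^ 2 := by
  classical
  have hex : ∀ e : (⊤ : SimpleGraph V).edgeSet, ∃ u v, (e : Sym2 V) = s(u, v) := by
    rintro ⟨e, -⟩
    induction e using Sym2.ind with
    | _ u v => exact ⟨u, v, rfl⟩
  choose src tgt hst using hex
  have hsd : ∀ e : (⊤ : SimpleGraph V).edgeSet, src e ≠ tgt e := by
    intro e
    have := e.2
    rw [hst e] at this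
    simpa using this
  have hle : ∀ w, G.congestion φ w ≤ x := fun w =>
    (le_ciSup (f := fun w => G.congestion φ w) (Set.finite_range _).bddAbove w).trans hx.le
  let R : Finset (V × V) := Finset.univ.filter fun r => G.Adj r.1 r.2 ∨ r.1 = r.2
  have hRcard : R.card = 2 * G.edgeFinset.card + Fintype.card V := by
    simp only [R]
    rw [Finset.filter_or, Finset.card_union_of_disjoint]
    · congr 1
      · rw [← G.dart_card_eq_twice_card_edges, Fintype.card]
        refine (Finset.card_bij (fun d _ => d.toProd) ?_ ?_ ?_).symm
        · intro d _; simp [d.adj]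
        · intro a _ b _ h; exact SimpleGraph.Dart.ext _ _ h
        · intro b hb; exact ⟨⟨b, by simpa using hb⟩, by simp, rfl⟩
      · rw [Fintype.card]
        refine (Finset.card_bij (fun v _ => (v, v)) ?_ ?_ ?_).symm
        · intro v _; simp
        · intro a _ b _ h; simpa using h
        · rintro ⟨a, b⟩ hb; exact ⟨a, by simp, by simpa using hb⟩
    · rw [Finset.disjoint_filter]
      rintro ⟨a, b⟩ - h h'
      exact h.ne h'
  have h1 : ∀ u v : V, u ≠ v → ∑ p : G.Path u v, φ u v p = 1 := by
    intro u v huv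
    rw [← hφ.2.2 u v huv]
    congr!
  obtain ⟨c, hc⟩ := exists_choice (V := V) (fun e => G.Path (src e) (tgt e))
    (fun e p => φ (src e) (tgt e) p) (fun e p => (hφ.1 _ _ _).1) (fun e => h1 _ _ (hsd e))
    (fun w e p => if w ∈ p.1.support then 1 else 0) (fun w e p => by split_ifs <;> norm_num)
    R (2 * x) (fun w => (flow_bound G φ hφ src tgt hst w).trans (by linarith [hle w]))
  obtain ⟨D, hD⟩ := exists_drawing hstring src tgt hst (fun e => (c e).1)
  refine ⟨D, ?_⟩
  set S : Set ((⊤ : SimpleGraph V).edgeSet × (⊤ : SimpleGraph V).edgeSet) :=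
    {p | p.1 ≠ p.2 ∧ (D.crossSet p.1 p.2).Nonempty} with hS
  let M : ℕ := (Finset.univ.filter fun p : (⊤ : SimpleGraph V).edgeSet × (⊤ : SimpleGraph V).edgeSet =>
    p.1 ≠ p.2 ∧ (D.crossSet p.1 p.2).Nonempty).card
  have hM : D.crossingPairCount = M / 2 := by
    unfold SimpleGraph.Drawing.crossingPairCount
    rw [Nat.card_eq_fintype_card, Fintype.card_subtype]
  have hMle : (M : ℝ) ≤ R.card * (2 * x) ^ 2 := by
    refine le_trans ?_ hc
    simp only [M]
    rw [Finset.card_filter]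
    push_cast
    refine Finset.sum_le_sum fun q _ => ?_
    have hnn : ∀ r ∈ R, (0 : ℝ) ≤ (if r.1 ∈ (c q.1).1.support then 1 else 0) *
        (if r.2 ∈ (c q.2).1.support then 1 else 0) := by
      intro r _; split_ifs <;> norm_num
    by_cases hq : q.1 ≠ q.2
    · rw [if_pos hq]
      split_ifs with h
      · obtain ⟨w, hw, w', hw', hr⟩ := hD q.1 q.2 hq h.2
        have hmem : (w, w') ∈ R := by simp [R, hr]
        refine le_trans ?_ (Finset.single_le_sum hnn hmem)
        simp [hw, hw']
      · exact Finset.sum_nonneg hnn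
    · rw [if_neg hq, if_neg (fun h => hq h.1)]
  have hMhalf : (D.crossingPairCount : ℝ) ≤ M / 2 := by
    rw [hM]; exact Nat.cast_div_le
  rcases subsingleton_or_nontrivial V with hsub | hnt
  · have : M = 0 := by
      apply Finset.card_eq_zero.2
      apply Finset.filter_eq_empty_iff.2
      intro q _
      exact absurd (Subsingleton.elim _ _) (hsd q.1)
    rw [this] at hMhalf
    have : (0 : ℝ) ≤ 8 * G.edgeFinset.card * x ^ 2 := by positivity
    simp at hMhalf ⊢
    rw [hMhalf]; simpa using this
  · have hn : Fintype.card V ≤ 2 * G.edgeFinset.card := by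
      have h2 := hconn.card_vert_le_card_edgeSet_add_one
      rw [Nat.card_eq_fintype_card, Nat.card_eq_fintype_card] at h2
      rw [← SimpleGraph.edgeFinset_card] at h2
      have h3 := Fintype.one_lt_card (α := V)
      omega
    have hR' : (R.card : ℝ) ≤ 4 * G.edgeFinset.card := by
      rw [hRcard]; exact_mod_cast (by omega)
    nlinarith [mul_le_mul_of_nonneg_right hR' (sq_nonneg (2 * x))]

end Helpers

/-- For a connected string graph `G` with `n` vertices and `m` edges, the complete
graph on the vertex set of `G` has a drawing with at most `8·m·vcong(G)²` crossing
pairs of edges; in particular `pcr(Kₙ) ≤ 8·m·vcong(G)²`. -/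
theorem complete_graph_drawing_of_stringGraph
    (V : Type) [Fintype V] [DecidableEq V] (G : SimpleGraph V) [DecidableRel G.Adj]
    (hconn : G.Connected) (hstring : G.IsStringGraph) :
    (∃ D : (⊤ : SimpleGraph V).Drawing,
        (D.crossingPairCount : ℝ) ≤ 8 * G.edgeFinset.card * G.vcong ^ 2) ∧
      ((⊤ : SimpleGraph V).pcr : ℝ) ≤ 8 * G.edgeFinset.card * G.vcong ^ 2 := by

  have key : ((⊤ : SimpleGraph V).pcr : ℝ) ≤ 8 * G.edgeFinset.card * G.vcong ^ 2 := by
    have hev : ∀ x, G.vcong < x → ((⊤ : SimpleGraph V).pcr : ℝ) ≤ 8 * G.edgeFinset.card * x ^ 2 := by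
      intro x hx
      obtain ⟨φ₀, hφ₀⟩ := exists_flow G hconn
      have hne : { x : ℝ | ∃ φ : ∀ u v : V, G.Path u v → ℝ,
          G.IsMCFlow φ ∧ x = ⨆ w : V, G.congestion φ w }.Nonempty := ⟨_, φ₀, hφ₀, rfl⟩
      obtain ⟨y, ⟨φ, hφ, rfl⟩, hy⟩ := exists_lt_of_csInf_lt hne hx
      obtain ⟨D, hD⟩ := pcr_le_of_flow G hconn hstring φ hφ x hy
      refine le_trans ?_ hD
      have : (⊤ : SimpleGraph V).pcr ≤ D.crossingPairCount := Nat.sInf_le ⟨D, rfl⟩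
      exact_mod_cast this
    have ht : Filter.Tendsto (fun x : ℝ => 8 * (G.edgeFinset.card : ℝ) * x ^ 2)
        (nhdsWithin G.vcong (Set.Ioi G.vcong)) (nhds (8 * G.edgeFinset.card * G.vcong ^ 2)) := by
      apply Filter.Tendsto.mono_left _ nhdsWithin_le_nhds
      exact (by fun_prop : Continuous (fun x : ℝ => 8 * (G.edgeFinset.card : ℝ) * x ^ 2)).tendsto _
    refine ge_of_tendsto ht ?_
    filter_upwards [self_mem_nhdsWithin] with x hx
    exact hev x hx
  refine ⟨?_, key⟩
  have hne : { k : ℕ | ∃ D : (⊤ : SimpleGraph V).Drawing, D.crossingPairCount = k }.Nonempty := by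
    obtain ⟨φ₀, hφ₀⟩ := exists_flow G hconn
    obtain ⟨D, hD⟩ := pcr_le_of_flow G hconn hstring φ₀ hφ₀ _ (lt_add_one _)
    exact ⟨_, D, rfl⟩
  obtain ⟨D, hD⟩ := Nat.sInf_mem hne
  refine ⟨D, ?_⟩
  rw [hD]
  exact key
end

section
/- Let G = (V, E) be a connected graph with n vertices and m edges, and let φ be an all-pair unit-demand multicommodity flow in G attaining vcong(G). For each pair {u,v} of distinct vertices, choose a random path P_{uv} ∈ 𝒫_{uv}, where each P ∈ 𝒫_{uv} is chosen with probability φ(P), independently for different pairs. Then the expected number of unordered pairs {{u,v}, {u',v'}} of distinct pairs of vertices for which there exist vertices w on P_{uv} and w' on P_{u'v'} with {w,w'} ∈ E or w = w' is at most 4·(m + n)·vcong(G)². -/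
open Finset

theorem indep_pair {ι : Type*} [Fintype ι] [DecidableEq ι] {α : ι → Type*} [∀ i, Fintype (α i)]
    (f : ∀ i, α i → ℝ) (hf : ∀ i, ∑ p, f i p = 1) (a b : ι) (hab : a ≠ b)
    (X : α a → ℝ) (Y : α b → ℝ) :
    ∑ ω : (∀ i, α i), (∏ i, f i (ω i)) * (X (ω a) * Y (ω b)) =
      (∑ p, f a p * X p) * (∑ p, f b p * Y p) := by
  classical
  let g : ∀ i, α i → ℝ := fun i p =>
    f i p * ((if h : i = a then X (h ▸ p) else 1) * (if h : i = b then Y (h ▸ p) else 1))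
  have h1 : ∏ i, ∑ p, g i p = ∑ ω : (∀ i, α i), ∏ i, g i (ω i) := by
    rw [Finset.prod_univ_sum, Fintype.piFinset_univ]
  have h2 : ∀ ω : (∀ i, α i), ∏ i, g i (ω i) =
      (∏ i, f i (ω i)) * (X (ω a) * Y (ω b)) := by
    intro ω
    simp only [g, Finset.prod_mul_distrib]
    congr 1
    congr 1
    · rw [Fintype.prod_eq_single a]
      · simp
      · intro x hx; simp [hx]
    · rw [Fintype.prod_eq_single b]
      · simp
      · intro x hx; simp [hx]
  rw [← Finset.sum_congr rfl (fun ω _ => h2 ω), ← h1, Fintype.prod_eq_mul a b hab]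
  · simp [g, hab, hab.symm]
  · rintro x ⟨hx1, hx2⟩
    simp [g, hx1, hx2, hf]

theorem pathCoeff_reverse {V : Type*} (G : SimpleGraph V) (w : V) {u v : V} (p : G.Walk u v) :
    pathCoeff G w p.reverse = pathCoeff G w p := by
  have h1 : w ∈ p.reverse.support ↔ w ∈ p.support := by simp
  unfold pathCoeff
  by_cases h : w ∈ p.support
  · rw [if_pos h, if_pos (h1.2 h)]
    by_cases h2 : w = u ∨ w = v
    · rw [if_pos h2, if_pos h2.symm]
    · rw [if_neg h2, if_neg (fun h' => h2 h'.symm)]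
  · rw [if_neg h, if_neg (fun h' => h (h1.1 h'))]

theorem pathCoeff_ge {V : Type*} [DecidableEq V] (G : SimpleGraph V) (w : V) {u v : V} (p : G.Walk u v) :
    (1 / 2) * (if w ∈ p.support then (1 : ℝ) else 0) ≤ pathCoeff G w p := by
  unfold pathCoeff
  split_ifs <;> norm_num

theorem half_sum {V : Type*} [Fintype V] [LinearOrder V] (g : V → V → ℝ)
    (h0 : ∀ u v, 0 ≤ g u v) (hs : ∀ u v, g u v = g v u) :
    ∑ a : {q : V × V // q.1 < q.2}, g a.1.1 a.1.2 ≤ (1 / 2) * ∑ u, ∑ v, g u v := by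
  have e1 : ∑ a : {q : V × V // q.1 < q.2}, g a.1.1 a.1.2 =
      ∑ u, ∑ v, if u < v then g u v else 0 := by
    rw [← Fintype.sum_prod_type' (f := fun u v => if u < v then g u v else 0),
      ← Finset.sum_filter]
    exact (Finset.sum_subtype _ (by simp) (fun q : V × V => g q.1 q.2)).symm
  have e2 : (∑ u, ∑ v, if u < v then g u v else 0) = ∑ u, ∑ v, if v < u then g u v else 0 := by
    rw [Finset.sum_comm]
    refine Finset.sum_congr rfl fun u _ => Finset.sum_congr rfl fun v _ => ?_
    rw [hs]
  have e3 : (∑ u, ∑ v, if u < v then g u v else 0) + (∑ u, ∑ v, if v < u then g u v else 0)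
      ≤ ∑ u, ∑ v, g u v := by
    rw [← Finset.sum_add_distrib]
    refine Finset.sum_le_sum fun u _ => ?_
    rw [← Finset.sum_add_distrib]
    refine Finset.sum_le_sum fun v _ => ?_
    have := h0 u v
    rcases lt_trichotomy u v with h | h | h
    · simp [h, h.not_gt]
    · subst h; simpa using this
    · simp [h, h.not_gt]
  rw [e1]
  linarith

theorem load_le {V : Type} [Fintype V] [LinearOrder V]
    (G : SimpleGraph V) [DecidableRel G.Adj]
    (φ : ∀ u v : V, G.Path u v → ℝ) (hφ : G.IsMCFlow φ) (w : V) :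
    ∑ a : {q : V × V // q.1 < q.2}, ∑ p : G.Path a.1.1 a.1.2,
      φ a.1.1 a.1.2 p * (if w ∈ p.1.support then (1 : ℝ) else 0) ≤ 2 * G.congestion φ w := by
  obtain ⟨h01, hrev, -⟩ := hφ
  have hc : G.congestion φ w =
      (1 / 2) * ∑ u : V, ∑ v : V, ∑ p : G.Path u v, φ u v p * pathCoeff G w p.1 := by
    unfold SimpleGraph.congestion
    congr!
  have hp : ∀ {u v : V} (p : G.Walk u v), 0 ≤ pathCoeff G w p := by
    intro u v p
    unfold pathCoeff
    split_ifs <;> norm_num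
  have := half_sum (fun u v => ∑ p : G.Path u v, φ u v p * pathCoeff G w p.1)
    (fun u v => Finset.sum_nonneg fun p _ => mul_nonneg (h01 u v p).1 (hp _)) (fun u v => by
      refine Finset.sum_bij' (fun p _ => p.reverse) (fun p _ => p.reverse) ?_ ?_ ?_ ?_ ?_
      · simp
      · simp
      · intro p _; ext; simp [SimpleGraph.Path.reverse]
      · intro p _; ext; simp [SimpleGraph.Path.reverse]
      · intro p _
        rw [hrev]
        congr 1
        exact (pathCoeff_reverse G w p.1).symm)
  rw [hc]
  refine le_trans ?_ (mul_le_mul_of_nonneg_left this (by norm_num))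
  rw [Finset.mul_sum]
  refine Finset.sum_le_sum fun a _ => ?_
  rw [Finset.mul_sum]
  refine Finset.sum_le_sum fun p _ => ?_
  have h1 := mul_le_mul_of_nonneg_left (pathCoeff_ge G w p.1) (h01 _ _ p).1
  linarith

/-- Choosing, independently for each pair `{u,v}` of distinct vertices (indexed by
ordered pairs `u < v`), a random path `P_{uv} ∈ 𝒫_{uv}` with `ℙ[P_{uv} = P] = φ(P)`,
where `φ` is a flow attaining `vcong(G)`: the expected number of unordered pairs
`{{u,v},{u',v'}}` of distinct pairs for which there are vertices `w` on `P_{uv}` and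
`w'` on `P_{u'v'}` with `{w,w'} ∈ E(G)` or `w = w'` is at most `4·(m+n)·vcong(G)²`.
(The expectation is written as a finite sum over all outcomes `ω`, weighted by their
probabilities `∏ φ`, and the number of unordered pairs as half the number of ordered
ones.) -/
theorem expected_interacting_pairs_le
    (V : Type) [Fintype V] [LinearOrder V]
    (G : SimpleGraph V) [DecidableRel G.Adj] (hconn : G.Connected)
    (φ : ∀ u v : V, G.Path u v → ℝ) (hφ : G.IsMCFlow φ)
    (hopt : (⨆ w : V, G.congestion φ w) = G.vcong) :
    ∑ ω : (∀ a : {q : V × V // q.1 < q.2}, G.Path a.1.1 a.1.2),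
      (∏ a : {q : V × V // q.1 < q.2}, φ a.1.1 a.1.2 (ω a)) *
        (((Finset.univ.filter
            (fun ab : {q : V × V // q.1 < q.2} × {q : V × V // q.1 < q.2} =>
              ab.1 ≠ ab.2 ∧
                ∃ w ∈ (ω ab.1).1.support, ∃ w' ∈ (ω ab.2).1.support,
                  G.Adj w w' ∨ w = w')).card : ℝ) / 2)
      ≤ 4 * ((G.edgeFinset.card : ℝ) + Fintype.card V) * G.vcong ^ 2 := by
  classical
  have h01 := hφ.1
  have hsum : ∀ a : {q : V × V // q.1 < q.2}, ∑ p : G.Path a.1.1 a.1.2, φ a.1.1 a.1.2 p = 1 := by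
    intro a
    have := hφ.2.2 a.1.1 a.1.2 a.2.ne
    convert this
  have hC : ∀ w, G.congestion φ w ≤ G.vcong := fun w => by
    rw [← hopt]
    exact le_ciSup (Set.finite_range _).bddAbove w
  let L : V → {q : V × V // q.1 < q.2} → ℝ := fun w a =>
    ∑ p : G.Path a.1.1 a.1.2, φ a.1.1 a.1.2 p * (if w ∈ p.1.support then (1 : ℝ) else 0)
  have hL0 : ∀ w a, 0 ≤ L w a := fun w a =>
    Finset.sum_nonneg fun p _ => mul_nonneg (h01 _ _ p).1 (by split_ifs <;> norm_num)
  have hL : ∀ w, ∑ a, L w a ≤ 2 * G.vcong := fun w =>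
    (load_le G φ hφ w).trans (by linarith [hC w])
  let R : Finset (V × V) := Finset.univ.filter fun q => G.Adj q.1 q.2 ∨ q.1 = q.2
  have hR : (R.card : ℝ) = 2 * G.edgeFinset.card + Fintype.card V := by
    have : R.card = 2 * G.edgeFinset.card + Fintype.card V := by
      rw [← SimpleGraph.sum_degrees_eq_twice_card_edges]
      have e : R = (Finset.univ.filter fun q : V × V => G.Adj q.1 q.2) ∪
          (Finset.univ.filter fun q : V × V => q.1 = q.2) := by
        ext; simp [R]
      rw [e, Finset.card_union_of_disjoint]
      · congr 1
        · rw [Finset.card_filter, Fintype.sum_prod_type]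
          refine Finset.sum_congr rfl fun u _ => ?_
          rw [← Finset.card_filter, ← SimpleGraph.card_neighborFinset_eq_degree,
            SimpleGraph.neighborFinset_eq_filter]
        · rw [Finset.card_filter, Fintype.sum_prod_type]
          simp
      · rw [Finset.disjoint_left]
        rintro ⟨x, y⟩ h1 h2
        simp at h1 h2
        exact h1.ne h2
    exact_mod_cast this
  let I : V → ∀ a : {q : V × V // q.1 < q.2}, G.Path a.1.1 a.1.2 → ℝ := fun w a p =>
    if w ∈ p.1.support then (1 : ℝ) else 0
  have hI0 : ∀ w a p, 0 ≤ I w a p := fun w a p => by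
    simp only [I]; split_ifs <;> norm_num
  have hcard : ∀ ω : (∀ a : {q : V × V // q.1 < q.2}, G.Path a.1.1 a.1.2),
      ((Finset.univ.filter
            (fun ab : {q : V × V // q.1 < q.2} × {q : V × V // q.1 < q.2} =>
              ab.1 ≠ ab.2 ∧
                ∃ w ∈ (ω ab.1).1.support, ∃ w' ∈ (ω ab.2).1.support,
                  G.Adj w w' ∨ w = w')).card : ℝ) ≤
      ∑ ab : {q : V × V // q.1 < q.2} × {q : V × V // q.1 < q.2}, ∑ q ∈ R,
        if ab.1 ≠ ab.2 then I q.1 ab.1 (ω ab.1) * I q.2 ab.2 (ω ab.2) else 0 := by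
    intro ω
    rw [Finset.card_filter]
    push_cast
    refine Finset.sum_le_sum fun ab _ => ?_
    have hnn : ∀ q ∈ R, (0 : ℝ) ≤
        if ab.1 ≠ ab.2 then I q.1 ab.1 (ω ab.1) * I q.2 ab.2 (ω ab.2) else 0 := by
      intro q _
      split_ifs
      · exact mul_nonneg (hI0 _ _ _) (hI0 _ _ _)
      · exact le_rfl
    by_cases h : ab.1 ≠ ab.2 ∧ ∃ w ∈ (ω ab.1).1.support, ∃ w' ∈ (ω ab.2).1.support,
                  G.Adj w w' ∨ w = w'
    · rw [if_pos h]
      obtain ⟨hne, w, hw, w', hw', hadj⟩ := h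
      have hm : (w, w') ∈ R := by simpa [R] using hadj
      refine le_trans ?_ (Finset.single_le_sum hnn hm)
      simp [hne, I, hw, hw']
    · rw [if_neg h]
      exact Finset.sum_nonneg hnn
  have hprod0 : ∀ ω : (∀ a : {q : V × V // q.1 < q.2}, G.Path a.1.1 a.1.2),
      0 ≤ ∏ a : {q : V × V // q.1 < q.2}, φ a.1.1 a.1.2 (ω a) := fun ω =>
    Finset.prod_nonneg fun a _ => (h01 _ _ _).1
  have key : ∑ ω : (∀ a : {q : V × V // q.1 < q.2}, G.Path a.1.1 a.1.2),
      (∏ a : {q : V × V // q.1 < q.2}, φ a.1.1 a.1.2 (ω a)) *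
      (∑ ab : {q : V × V // q.1 < q.2} × {q : V × V // q.1 < q.2}, ∑ q ∈ R,
        if ab.1 ≠ ab.2 then I q.1 ab.1 (ω ab.1) * I q.2 ab.2 (ω ab.2) else 0)
      ≤ R.card * (4 * G.vcong ^ 2) := by
    calc _ = ∑ q ∈ R, ∑ ab : {q : V × V // q.1 < q.2} × {q : V × V // q.1 < q.2},
        ∑ ω : (∀ a : {q : V × V // q.1 < q.2}, G.Path a.1.1 a.1.2),
        (∏ a : {q : V × V // q.1 < q.2}, φ a.1.1 a.1.2 (ω a)) *
        (if ab.1 ≠ ab.2 then I q.1 ab.1 (ω ab.1) * I q.2 ab.2 (ω ab.2) else 0) := by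
          simp_rw [Finset.mul_sum]
          rw [Finset.sum_comm, Finset.sum_comm (s := R)]
          exact Finset.sum_congr rfl fun ab _ => Finset.sum_comm
      _ ≤ ∑ q ∈ R, ∑ ab : {q : V × V // q.1 < q.2} × {q : V × V // q.1 < q.2},
          L q.1 ab.1 * L q.2 ab.2 := by
          refine Finset.sum_le_sum fun q _ => Finset.sum_le_sum fun ab _ => ?_
          by_cases h : ab.1 = ab.2
          · simp only [h, ne_eq, not_true_eq_false, if_false, mul_zero, Finset.sum_const_zero]
            exact mul_nonneg (hL0 _ _) (hL0 _ _)
          · simp only [ne_eq, h, not_false_eq_true, if_true]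
            exact (indep_pair (fun a : {q : V × V // q.1 < q.2} => φ a.1.1 a.1.2) hsum
              ab.1 ab.2 h (I q.1 ab.1) (I q.2 ab.2)).le
      _ ≤ ∑ q ∈ R, 4 * G.vcong ^ 2 := by
          refine Finset.sum_le_sum fun q _ => ?_
          rw [Fintype.sum_prod_type, ← Finset.sum_mul_sum]
          have h0 : 0 ≤ ∑ a, L q.2 a := Finset.sum_nonneg fun a _ => hL0 _ _
          have h0' : 0 ≤ ∑ a, L q.1 a := Finset.sum_nonneg fun a _ => hL0 _ _
          have := mul_le_mul (hL q.1) (hL q.2) h0 (h0'.trans (hL _))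
          linarith
      _ = _ := by simp
  have hfin : ∑ ω : (∀ a : {q : V × V // q.1 < q.2}, G.Path a.1.1 a.1.2),
      (∏ a : {q : V × V // q.1 < q.2}, φ a.1.1 a.1.2 (ω a)) *
        (((Finset.univ.filter
            (fun ab : {q : V × V // q.1 < q.2} × {q : V × V // q.1 < q.2} =>
              ab.1 ≠ ab.2 ∧
                ∃ w ∈ (ω ab.1).1.support, ∃ w' ∈ (ω ab.2).1.support,
                  G.Adj w w' ∨ w = w')).card : ℝ) / 2)
      ≤ (R.card * (4 * G.vcong ^ 2)) / 2 := by
    refine le_trans ?_ (div_le_div_of_nonneg_right key (by norm_num))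
    rw [Finset.sum_div]
    refine Finset.sum_le_sum fun ω _ => ?_
    rw [mul_div_assoc]
    exact mul_le_mul_of_nonneg_left
      (div_le_div_of_nonneg_right (hcard ω) (by norm_num)) (hprod0 ω)
  rw [hR] at hfin
  have hn : 0 ≤ (Fintype.card V : ℝ) * G.vcong ^ 2 := by positivity
  have hfin2 : (2 * (G.edgeFinset.card : ℝ) + Fintype.card V) * (4 * G.vcong ^ 2) / 2 ≤
      4 * ((G.edgeFinset.card : ℝ) + Fintype.card V) * G.vcong ^ 2 := by linarith
  refine le_trans (le_of_eq ?_) (hfin.trans hfin2)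
  congr!
end
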